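/- arXiv:2212.08422 — 2 statements merged into one kernel-verified Lean document; each statement's English description precedes it below -/
import Mathlib

section
/- Let d ≥ 1 and m ≥ 2d+1 be integers and let 𝒯 be a triangulation of the cyclic polytope C(m, 2d). Then 𝒯 has exactly binomial(m−d−1, d) many d-faces A = {a_0 < a_1 < … < a_d} satisfying a_{i+1} ≥ a_i + 2 for all 0 ≤ i ≤ d−1. -/
open Finset

noncomputable section

/-- The moment curve `p_δ(t) = (t, t², …, t^δ)` in `ℝ^δ`. -/
def momCurve (δ : ℕ) (t : ℝ) : Fin δ → ℝ := fun i => t ^ (i.1 + 1)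

/-- The points `p_δ(a)` on the moment curve for `a` ranging over a finite set of naturals. -/
def momPts (δ : ℕ) (A : Finset ℕ) : Set (Fin δ → ℝ) :=
  (fun a : ℕ => momCurve δ (a : ℝ)) '' (A : Set ℕ)

/-- The simplex `|A|_δ`, i.e. the convex hull of the points `p_δ(a)`, `a ∈ A`. -/
def smp (δ : ℕ) (A : Finset ℕ) : Set (Fin δ → ℝ) := convexHull ℝ (momPts δ A)

/-- The cyclic polytope `C(m, δ) = conv{p_δ(1), …, p_δ(m)}`. -/
def cyc (m δ : ℕ) : Set (Fin δ → ℝ) := smp δ (Finset.Icc 1 m)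

/-- The last standard basis vector `e_δ` of `ℝ^δ`. -/
def eLast (δ : ℕ) : Fin δ → ℝ := fun i => if i.1 = δ - 1 then 1 else 0

/-- The last coordinate of a point of `ℝ^δ`. -/
def lastCoord {δ : ℕ} (x : Fin δ → ℝ) : ℝ :=
  if h : 0 < δ then x ⟨δ - 1, Nat.sub_lt h one_pos⟩ else 0

/-- `x` lies strictly above `V`: `x - r • e_δ ∈ V` for some `r > 0`. -/
def StrictlyAbove {δ : ℕ} (x : Fin δ → ℝ) (V : Set (Fin δ → ℝ)) : Prop :=
  ∃ r : ℝ, 0 < r ∧ x - r • eLast δ ∈ V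

/-- `x` lies strictly below `V`: `x - r • e_δ ∈ V` for some `r < 0`. -/
def StrictlyBelow {δ : ℕ} (x : Fin δ → ℝ) (V : Set (Fin δ → ℝ)) : Prop :=
  ∃ r : ℝ, r < 0 ∧ x - r • eLast δ ∈ V

/-- `|F|_δ` is a lower facet of the cyclic polytope `C(m, δ)`. -/
def IsLowerFacet (m δ : ℕ) (F : Finset ℕ) : Prop :=
  F ⊆ Finset.Icc 1 m ∧ F.card = δ ∧
    ∀ i ∈ Finset.Icc 1 m, i ∉ F →
      StrictlyAbove (momCurve δ (i : ℝ))
        ((affineSpan ℝ (momPts δ F) : AffineSubspace ℝ (Fin δ → ℝ)) : Set (Fin δ → ℝ))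

/-- `|F|_δ` is an upper facet of the cyclic polytope `C(m, δ)`. -/
def IsUpperFacet (m δ : ℕ) (F : Finset ℕ) : Prop :=
  F ⊆ Finset.Icc 1 m ∧ F.card = δ ∧
    ∀ i ∈ Finset.Icc 1 m, i ∉ F →
      StrictlyBelow (momCurve δ (i : ℝ))
        ((affineSpan ℝ (momPts δ F) : AffineSubspace ℝ (Fin δ → ℝ)) : Set (Fin δ → ℝ))

/-- The facet `|H ∖ {c}|_δ` of the simplex `|H|_δ` is a lower facet of `|H|_δ`. -/
def IsLowerFacetOfSimplex (δ : ℕ) (H : Finset ℕ) (c : ℕ) : Prop :=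
  c ∈ H ∧ StrictlyAbove (momCurve δ (c : ℝ))
    ((affineSpan ℝ (momPts δ (H.erase c)) : AffineSubspace ℝ (Fin δ → ℝ)) : Set (Fin δ → ℝ))

/-- The facet `|H ∖ {c}|_δ` of the simplex `|H|_δ` is an upper facet of `|H|_δ`. -/
def IsUpperFacetOfSimplex (δ : ℕ) (H : Finset ℕ) (c : ℕ) : Prop :=
  c ∈ H ∧ StrictlyBelow (momCurve δ (c : ℝ))
    ((affineSpan ℝ (momPts δ (H.erase c)) : AffineSubspace ℝ (Fin δ → ℝ)) : Set (Fin δ → ℝ))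

/-- `T` is a triangulation of the cyclic polytope `C(m, δ)`. -/
def IsTriangulation (m δ : ℕ) (T : Finset (Finset ℕ)) : Prop :=
  (∀ S ∈ T, S ⊆ Finset.Icc 1 m ∧ S.card = δ + 1) ∧
  (⋃ S ∈ T, smp δ S) = cyc m δ ∧
  ∀ S ∈ T, ∀ S' ∈ T, smp δ S ∩ smp δ S' = smp δ (S ∩ S')

/-- `A` is a face of the triangulation `T`. -/
def IsFace (T : Finset (Finset ℕ)) (A : Finset ℕ) : Prop := ∃ S ∈ T, A ⊆ S

/-- `A ≀ B`: writing `A = {a_0 < … < a_d}` and `B = {b_0 < … < b_d}`, we have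
`a_0 < b_0 < a_1 < b_1 < … < a_d < b_d`. -/
def Intertwines (d : ℕ) (A B : Finset ℕ) : Prop :=
  ∃ a b : Fin (d + 1) → ℕ, StrictMono a ∧ StrictMono b ∧
    A = Finset.image a Finset.univ ∧ B = Finset.image b Finset.univ ∧
    (∀ i, a i < b i) ∧ ∀ i : Fin d, b i.castSucc < a i.succ

/-- `y = ℓ_S(x)` is the lift of `x ∈ |S|_δ` to `ℝ^{δ+1}` given by the barycentric
coordinates of `x` with respect to the vertices of `|S|_δ`. -/
def IsLift (δ : ℕ) (S : Finset ℕ) (x : Fin δ → ℝ) (y : Fin (δ + 1) → ℝ) : Prop :=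
  ∃ w : ℕ → ℝ, (∀ a ∈ S, 0 ≤ w a) ∧ (∑ a ∈ S, w a) = 1 ∧
    (∑ a ∈ S, w a • momCurve δ (a : ℝ)) = x ∧
    (∑ a ∈ S, w a • momCurve (δ + 1) (a : ℝ)) = y

/-- `|A|_δ` is submerged by the triangulation `T`. -/
def Submerged (δ : ℕ) (T : Finset (Finset ℕ)) (A : Finset ℕ) : Prop :=
  ∀ S ∈ T, ∀ x ∈ smp δ A ∩ smp δ S, ∀ y y' : Fin (δ + 1) → ℝ,
    IsLift δ A x y → IsLift δ S x y' → lastCoord y ≤ lastCoord y'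

/-- `|A|_δ` is supermerged by the triangulation `T`. -/
def Supermerged (δ : ℕ) (T : Finset (Finset ℕ)) (A : Finset ℕ) : Prop :=
  ∀ S ∈ T, ∀ x ∈ smp δ A ∩ smp δ S, ∀ y y' : Fin (δ + 1) → ℝ,
    IsLift δ A x y → IsLift δ S x y' → lastCoord y' ≤ lastCoord y

/-- The second higher Stasheff–Tamari order `T ≤₂ T'`. -/
def HST2 (δ : ℕ) (T T' : Finset (Finset ℕ)) : Prop :=
  ∀ S ∈ T, ∀ S' ∈ T', ∀ x ∈ smp δ S ∩ smp δ S', ∀ y y' : Fin (δ + 1) → ℝ,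
    IsLift δ S x y → IsLift δ S' x y' → lastCoord y ≤ lastCoord y'

open scoped Classical in
/-- The lower triangulation of `C(m, δ)`: the collection of `(δ+1)`-element subsets `F` of
`{1, …, m}` such that `|F|_{δ+1}` is a lower facet of `C(m, δ+1)`. -/
def lowerTriang (m δ : ℕ) : Finset (Finset ℕ) :=
  (Finset.Icc 1 m).powerset.filter (fun F => IsLowerFacet m (δ + 1) F)

open scoped Classical in
/-- The upper triangulation of `C(m, δ)`. -/
def upperTriang (m δ : ℕ) : Finset (Finset ℕ) :=
  (Finset.Icc 1 m).powerset.filter (fun F => IsUpperFacet m (δ + 1) F)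

open scoped Classical in
/-- `L(H)`: the `(δ+1)`-element subsets `G` of `H` with `|G|_{δ+1}` a lower facet of the
simplex `|H|_{δ+1}`. -/
def LH (δ : ℕ) (H : Finset ℕ) : Finset (Finset ℕ) :=
  (H.filter (fun c => IsLowerFacetOfSimplex (δ + 1) H c)).image (fun c => H.erase c)

open scoped Classical in
/-- `U(H)`: the `(δ+1)`-element subsets `G` of `H` with `|G|_{δ+1}` an upper facet of the
simplex `|H|_{δ+1}`. -/
def UH (δ : ℕ) (H : Finset ℕ) : Finset (Finset ℕ) :=
  (H.filter (fun c => IsUpperFacetOfSimplex (δ + 1) H c)).image (fun c => H.erase c)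

/-! ### Barycentric coordinates on the moment curve -/

theorem mem_smp_iff {δ : ℕ} {A : Finset ℕ} {x : Fin δ → ℝ} :
    x ∈ smp δ A ↔ ∃ w : ℕ → ℝ, (∀ a ∈ A, 0 ≤ w a) ∧ ∑ a ∈ A, w a = 1 ∧
      ∑ a ∈ A, w a • momCurve δ (a : ℝ) = x := by
  constructor
  · intro hx
    have hconv : Convex ℝ {x : Fin δ → ℝ | ∃ w : ℕ → ℝ, (∀ a ∈ A, 0 ≤ w a) ∧
        ∑ a ∈ A, w a = 1 ∧ ∑ a ∈ A, w a • momCurve δ (a : ℝ) = x} := by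
      rintro _ ⟨u, hu0, hu1, rfl⟩ _ ⟨v, hv0, hv1, rfl⟩ r s hr hs hrs
      refine ⟨fun a => r * u a + s * v a, fun a ha => ?_, ?_, ?_⟩
      · have := hu0 a ha
        have := hv0 a ha
        positivity
      · rw [sum_add_distrib, ← mul_sum, ← mul_sum, hu1, hv1]
        linarith
      · simp only [add_smul, mul_smul, sum_add_distrib, smul_sum]
    refine convexHull_min ?_ hconv hx
    rintro _ ⟨a, ha, rfl⟩
    refine ⟨fun b => if b = a then 1 else 0, fun b _ => by positivity, ?_, ?_⟩
    · simpa using ha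
    · simpa using fun h => absurd (mem_coe.1 ha) h
  · rintro ⟨w, hw0, hw1, rfl⟩
    exact (convex_convexHull ℝ _).sum_mem hw0 hw1
      fun a ha => subset_convexHull ℝ _ ⟨a, ha, rfl⟩

theorem sum_mul_eval_eq {δ : ℕ} (hδ : 1 ≤ δ) {S A : Finset ℕ} {u w : ℕ → ℝ} {s : ℝ}
    (hsum : ∑ a ∈ S, u a = ∑ a ∈ A, w a)
    (hpt : ∑ a ∈ S, u a • momCurve δ (a : ℝ) =
      ∑ a ∈ A, w a • momCurve δ (a : ℝ) + s • eLast δ)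
    {P : Polynomial ℝ} (hP : P.natDegree ≤ δ) :
    ∑ a ∈ S, u a * P.eval (a : ℝ) = ∑ a ∈ A, w a * P.eval (a : ℝ) + s * P.coeff δ := by
  have hmom : ∀ k ∈ range (δ + 1), ∑ a ∈ S, u a * (a : ℝ) ^ k =
      ∑ a ∈ A, w a * (a : ℝ) ^ k + if k = δ then s else 0 := by
    rintro (_ | k) hk
    · simpa [show (0 : ℕ) ≠ δ by lia] using hsum
    · have hk' : k < δ := by simpa using hk
      have h := congrFun hpt ⟨k, hk'⟩
      simp only [momCurve, eLast, Finset.sum_apply, Pi.smul_apply, Pi.add_apply, smul_eq_mul,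
        mul_ite, mul_one, mul_zero] at h
      rw [h]
      simp only [show (k = δ - 1) ↔ (k + 1 = δ) by lia]
  have hexp : ∀ (B : Finset ℕ) (v : ℕ → ℝ), ∑ a ∈ B, v a * P.eval (a : ℝ) =
      ∑ k ∈ range (δ + 1), P.coeff k * ∑ a ∈ B, v a * (a : ℝ) ^ k := by
    intro B v
    simp_rw [Polynomial.eval_eq_sum_range' (Nat.lt_succ_of_le hP), mul_sum]
    rw [sum_comm]
    exact sum_congr rfl fun k _ => sum_congr rfl fun a _ => by ring
  rw [hexp, hexp, sum_congr rfl fun k hk => by rw [hmom k hk]]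
  simp [mul_add, sum_add_distrib, mul_comm]

/-- The monic polynomial vanishing exactly on `A`. -/
def vanishPoly (A : Finset ℕ) : Polynomial ℝ := Lagrange.nodal A (fun n : ℕ => (n : ℝ))

theorem natDegree_vanishPoly (A : Finset ℕ) : (vanishPoly A).natDegree = #A :=
  Lagrange.natDegree_nodal

theorem coeff_vanishPoly (A : Finset ℕ) : (vanishPoly A).coeff #A = 1 := by
  rw [← natDegree_vanishPoly]
  exact Lagrange.nodal_monic

theorem eval_vanishPoly (A : Finset ℕ) (x : ℝ) :
    (vanishPoly A).eval x = ∏ a ∈ A, (x - a) :=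
  Lagrange.eval_nodal

theorem eval_vanishPoly_eq_zero {A : Finset ℕ} {a : ℕ} (ha : a ∈ A) :
    (vanishPoly A).eval (a : ℝ) = 0 :=
  Lagrange.eval_nodal_at_node ha

theorem sum_mul_eval_vanishPoly_erase {S : Finset ℕ} {a : ℕ} (ha : a ∈ S) (u : ℕ → ℝ) :
    ∑ b ∈ S, u b * (vanishPoly (S.erase a)).eval (b : ℝ) =
      u a * (vanishPoly (S.erase a)).eval (a : ℝ) :=
  sum_eq_single_of_mem a ha fun b hb hba => by
    rw [eval_vanishPoly_eq_zero (mem_erase.2 ⟨hba, hb⟩), mul_zero]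

/-- The number of elements of `S` that are larger than `h`. -/
def numAbove (S : Finset ℕ) (h : ℕ) : ℕ := #{x ∈ S | h < x}

theorem sign_mul_eval_vanishPoly_pos {S : Finset ℕ} {h : ℕ} (hS : h ∉ S) :
    0 < (-1 : ℝ) ^ numAbove S h * (vanishPoly S).eval (h : ℝ) := by
  have hsign : (-1 : ℝ) ^ numAbove S h = ∏ x ∈ S, if h < x then (-1 : ℝ) else 1 := by
    rw [prod_ite, prod_const, prod_const_one, mul_one, numAbove]
  rw [hsign, eval_vanishPoly, ← prod_mul_distrib]
  refine prod_pos fun x hx => ?_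
  have hne : x ≠ h := fun e => hS (e ▸ hx)
  split_ifs with hlt
  · have : (h : ℝ) < x := by exact_mod_cast hlt
    linarith
  · have : (x : ℝ) < h := by exact_mod_cast (show x < h by lia)
    linarith

theorem numAbove_erase_self (S : Finset ℕ) (h : ℕ) :
    numAbove (S.erase h) h = numAbove S h := by
  unfold numAbove
  congr 1
  ext x
  simp only [mem_filter, mem_erase]
  exact ⟨fun hx => ⟨hx.1.2, hx.2⟩, fun hx => ⟨⟨hx.2.ne', hx.1⟩, hx.2⟩⟩

theorem sign_mul_eval_vanishPoly_erase_pos (S : Finset ℕ) (h : ℕ) :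
    0 < (-1 : ℝ) ^ numAbove S h * (vanishPoly (S.erase h)).eval (h : ℝ) := by
  rw [← numAbove_erase_self]
  exact sign_mul_eval_vanishPoly_pos (notMem_erase h S)

theorem weights_eq {δ : ℕ} (hδ : 1 ≤ δ) {S : Finset ℕ} (hS : #S ≤ δ + 1) {u w : ℕ → ℝ}
    (hsum : ∑ a ∈ S, u a = ∑ a ∈ S, w a)
    (hpt : ∑ a ∈ S, u a • momCurve δ (a : ℝ) = ∑ a ∈ S, w a • momCurve δ (a : ℝ))
    {a : ℕ} (ha : a ∈ S) : u a = w a := by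
  have hdeg : (vanishPoly (S.erase a)).natDegree ≤ δ := by
    rw [natDegree_vanishPoly, card_erase_of_mem ha]
    lia
  have h := sum_mul_eval_eq hδ (s := 0) hsum (by simpa using hpt) hdeg
  rw [sum_mul_eval_vanishPoly_erase ha, sum_mul_eval_vanishPoly_erase ha, zero_mul,
    add_zero] at h
  have hne := sign_mul_eval_vanishPoly_erase_pos S a
  exact mul_right_cancel₀ (fun h0 => by simp [h0] at hne) h

/-! ### Uniform weights -/

/-- The weights of the centroid of the vertices in `A`. -/
def unifWeight (A : Finset ℕ) (a : ℕ) : ℝ := if a ∈ A then (#A : ℝ)⁻¹ else 0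

/-- The centroid of the points `p_δ(a)`, `a ∈ A`. -/
def centroidPt (δ : ℕ) (A : Finset ℕ) : Fin δ → ℝ :=
  ∑ a ∈ A, unifWeight A a • momCurve δ (a : ℝ)

theorem unifWeight_nonneg (A : Finset ℕ) (a : ℕ) : 0 ≤ unifWeight A a := by
  unfold unifWeight
  positivity

theorem unifWeight_pos {A : Finset ℕ} {a : ℕ} (ha : a ∈ A) : 0 < unifWeight A a := by
  have : 0 < #A := card_pos.2 ⟨a, ha⟩
  rw [unifWeight, if_pos ha]
  positivity

theorem unifWeight_eq_zero {A : Finset ℕ} {a : ℕ} (ha : a ∉ A) : unifWeight A a = 0 :=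
  if_neg ha

theorem sum_unifWeight {A S : Finset ℕ} (hA : A.Nonempty) (hAS : A ⊆ S) :
    ∑ a ∈ S, unifWeight A a = 1 := by
  have hconst : ∀ a ∈ A, unifWeight A a = (#A : ℝ)⁻¹ := fun a ha => if_pos ha
  rw [← sum_subset hAS fun a _ ha => unifWeight_eq_zero ha, sum_congr rfl hconst, sum_const,
    nsmul_eq_mul]
  exact mul_inv_cancel₀ (by exact_mod_cast hA.card_pos.ne')

theorem sum_unifWeight_smul {δ : ℕ} {A S : Finset ℕ} (hAS : A ⊆ S) :
    ∑ a ∈ S, unifWeight A a • momCurve δ (a : ℝ) = centroidPt δ A :=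
  (sum_subset hAS fun a _ ha => by rw [unifWeight_eq_zero ha, zero_smul]).symm

theorem centroidPt_mem_smp {δ : ℕ} {A S : Finset ℕ} (hA : A.Nonempty) (hAS : A ⊆ S) :
    centroidPt δ A ∈ smp δ S :=
  mem_smp_iff.2 ⟨unifWeight A, fun a _ => unifWeight_nonneg A a, sum_unifWeight hA hAS,
    sum_unifWeight_smul hAS⟩

/-- If weights on `S' ⊆ S` represent a point having positive barycentric coordinates on `A`
with respect to the simplex `S`, then `A ⊆ S'`. -/
theorem subset_of_pos_weights {δ : ℕ} (hδ : 1 ≤ δ) {S S' A : Finset ℕ} (hS : #S ≤ δ + 1)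
    (hS' : S' ⊆ S) (hAS : A ⊆ S) {w : ℕ → ℝ} (hw1 : ∑ a ∈ S, w a = 1)
    (hwA : ∀ a ∈ A, 0 < w a)
    (hmem : ∑ a ∈ S, w a • momCurve δ (a : ℝ) ∈ smp δ S') : A ⊆ S' := by
  obtain ⟨u, -, hu1, hup⟩ := mem_smp_iff.1 hmem
  intro a ha
  by_contra ha'
  have h := weights_eq hδ hS (u := fun b => if b ∈ S' then u b else 0) (w := w)
    (by simp [sum_ite_mem, inter_eq_right.2 hS', hu1, hw1])
    (by simp [ite_smul, sum_ite_mem, inter_eq_right.2 hS', hup]) (hAS ha)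
  simp only [if_neg ha'] at h
  exact (hwA a ha).ne h

/-! ### Moving from a face in the direction of the last coordinate -/

/-- `A ⊆ S`, and each element of `S ∖ A` has sign `σ`, where the sign of `h` in `S` is the
parity of the number of larger elements of `S`. -/
def IsSignedFace (σ : ℝ) (A S : Finset ℕ) : Prop :=
  A ⊆ S ∧ ∀ h ∈ S, h ∉ A → (-1 : ℝ) ^ numAbove S h = σ

theorem exists_circuit {δ : ℕ} (hδ : 1 ≤ δ) {S : Finset ℕ} (hS : #S = δ + 1) :
    ∃ c : ℕ → ℝ, (∀ h, 0 < (-1 : ℝ) ^ numAbove S h * c h) ∧ ∑ h ∈ S, c h = 0 ∧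
      ∑ h ∈ S, c h • momCurve δ (h : ℝ) = eLast δ := by
  have hinj : Set.InjOn (fun n : ℕ => (n : ℝ)) S := Nat.cast_injective.injOn
  have hmom : ∀ k ≤ δ, ∑ h ∈ S, (h : ℝ) ^ k / (vanishPoly (S.erase h)).eval (h : ℝ) =
      if k = δ then 1 else 0 := by
    intro k hk
    have h := Lagrange.coeff_eq_sum hinj (P := Polynomial.X ^ k) (by
      rw [Polynomial.degree_X_pow, hS]
      exact_mod_cast Nat.lt_succ_of_le hk)
    simp only [hS, Polynomial.coeff_X_pow, Polynomial.eval_pow, Polynomial.eval_X,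
      Nat.add_sub_cancel] at h
    simp_rw [eval_vanishPoly, ← h, eq_comm]
  refine ⟨fun h => ((vanishPoly (S.erase h)).eval (h : ℝ))⁻¹, fun h => ?_, ?_, ?_⟩
  · have hpos := sign_mul_eval_vanishPoly_erase_pos S h
    have hinv := inv_pos.2 hpos
    rwa [mul_inv, ← inv_pow, inv_neg, inv_one] at hinv
  · simpa [show (0 : ℕ) ≠ δ by lia] using hmom 0 (by lia)
  · ext ⟨k, hk⟩
    have h := hmom (k + 1) hk
    simp only [momCurve, eLast, Finset.sum_apply, Pi.smul_apply, smul_eq_mul]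
    simp only [show (k = δ - 1) ↔ (k + 1 = δ) by lia, ← h]
    exact sum_congr rfl fun a _ => by ring

theorem IsSignedFace.exists_pos_weights {δ : ℕ} (hδ : 1 ≤ δ) {A S : Finset ℕ} {σ : ℝ}
    (hA : A.Nonempty) (hS : #S = δ + 1) (hAS : IsSignedFace σ A S) :
    ∀ᶠ ε in nhdsWithin (0 : ℝ) (Set.Ioi 0), ∃ w : ℕ → ℝ, (∀ a ∈ S, 0 < w a) ∧
      ∑ a ∈ S, w a = 1 ∧
      ∑ a ∈ S, w a • momCurve δ (a : ℝ) = centroidPt δ A + (ε * σ) • eLast δ := by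
  obtain ⟨c, hcpos, hc0, hcp⟩ := exists_circuit hδ hS
  have hev : ∀ᶠ ε in nhdsWithin (0 : ℝ) (Set.Ioi 0), ∀ a ∈ S,
      0 < unifWeight A a + ε * σ * c a := by
    rw [Filter.eventually_all_finset]
    intro a ha
    by_cases haA : a ∈ A
    · have hcont : ContinuousAt (fun ε : ℝ => unifWeight A a + ε * σ * c a) 0 := by fun_prop
      exact (hcont.eventually_const_lt (by simpa using unifWeight_pos haA)).filter_mono
        nhdsWithin_le_nhds
    · filter_upwards [self_mem_nhdsWithin] with ε hε
      have hpos := hcpos a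
      rw [hAS.2 a ha haA] at hpos
      rw [unifWeight_eq_zero haA, zero_add, mul_assoc]
      exact mul_pos hε hpos
  filter_upwards [hev] with ε hε
  refine ⟨fun a => unifWeight A a + ε * σ * c a, hε, ?_, ?_⟩
  · rw [sum_add_distrib, sum_unifWeight hA hAS.1, ← mul_sum, hc0, mul_zero, add_zero]
  · simp only [add_smul, mul_smul, sum_add_distrib, sum_unifWeight_smul hAS.1, ← smul_sum, hcp]

theorem isSignedFace_of_mem_smp {δ : ℕ} (hδ : 1 ≤ δ) {A S : Finset ℕ} {σ ε : ℝ}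
    (hA : A.Nonempty) (hS : #S = δ + 1) (hσ : σ = 1 ∨ σ = -1) (hAS : A ⊆ S) (hε : 0 < ε)
    (hmem : centroidPt δ A + (ε * σ) • eLast δ ∈ smp δ S) : IsSignedFace σ A S := by
  refine ⟨hAS, fun h hh hhA => ?_⟩
  obtain ⟨u, hu0, hu1, hup⟩ := mem_smp_iff.1 hmem
  have hcard : #(S.erase h) = δ := by
    rw [card_erase_of_mem hh, hS, Nat.add_sub_cancel]
  have heq := sum_mul_eval_eq hδ (S := S) (A := A) (u := u) (w := unifWeight A) (s := ε * σ)
    (by rw [hu1, sum_unifWeight hA subset_rfl]) hup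
    (P := vanishPoly (S.erase h)) (by rw [natDegree_vanishPoly, hcard])
  have hzero : ∑ a ∈ A, unifWeight A a * (vanishPoly (S.erase h)).eval (a : ℝ) = 0 :=
    sum_eq_zero fun a ha => by
      rw [eval_vanishPoly_eq_zero (mem_erase.2 ⟨ne_of_mem_of_not_mem ha hhA, hAS ha⟩), mul_zero]
  have hcoeff := coeff_vanishPoly (S.erase h)
  rw [hcard] at hcoeff
  rw [sum_mul_eval_vanishPoly_erase hh, hzero, hcoeff, zero_add, mul_one] at heq
  have hpos := sign_mul_eval_vanishPoly_erase_pos S h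
  have huh := hu0 h hh
  set E := (vanishPoly (S.erase h)).eval (h : ℝ)
  rcases neg_one_pow_eq_or ℝ (numAbove S h) with hs | hs <;> rw [hs] at hpos ⊢ <;>
    rcases hσ with rfl | rfl
  · rfl
  · have := mul_nonneg huh (by linarith : 0 ≤ E)
    linarith
  · have := mul_nonneg huh (by linarith : 0 ≤ -E)
    linarith
  · rfl

theorem smp_mono {δ : ℕ} {A B : Finset ℕ} (hAB : A ⊆ B) : smp δ A ⊆ smp δ B :=
  convexHull_mono (Set.image_mono (coe_subset.2 hAB))

theorem isClosed_smp (δ : ℕ) (A : Finset ℕ) : IsClosed (smp δ A) :=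
  (A.finite_toSet.image _).isClosed_convexHull ℝ

theorem IsTriangulation.exists_mem_smp {m δ : ℕ} {T : Finset (Finset ℕ)}
    (hT : IsTriangulation m δ T) {x : Fin δ → ℝ} (hx : x ∈ cyc m δ) : ∃ S ∈ T, x ∈ smp δ S := by
  rw [← hT.2.1] at hx
  simpa using hx

theorem IsTriangulation.exists_isSignedFace {m δ : ℕ} {T : Finset (Finset ℕ)}
    (hT : IsTriangulation m δ T) (hδ : 1 ≤ δ) {A H : Finset ℕ} {σ : ℝ} (hA : A.Nonempty)
    (hσ : σ = 1 ∨ σ = -1) (hface : IsFace T A) (hH : H ⊆ Icc 1 m) (hHcard : #H = δ + 1)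
    (hAH : IsSignedFace σ A H) : ∃ S ∈ T, IsSignedFace σ A S := by
  obtain ⟨S₀, hS₀, hAS₀⟩ := hface
  obtain ⟨S, hS, hxS, ε, hε, hεS⟩ : ∃ S ∈ T, centroidPt δ A ∈ smp δ S ∧
      ∃ ε : ℝ, 0 < ε ∧ centroidPt δ A + (ε * σ) • eLast δ ∈ smp δ S := by
    by_contra! hcon
    have hev : ∀ᶠ ε in nhdsWithin (0 : ℝ) (Set.Ioi 0), ∀ S ∈ T,
        centroidPt δ A + (ε * σ) • eLast δ ∉ smp δ S := by
      rw [Filter.eventually_all_finset]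
      intro S hS
      by_cases hx : centroidPt δ A ∈ smp δ S
      · filter_upwards [self_mem_nhdsWithin] with ε hε using hcon S hS hx ε hε
      · have hcont : ContinuousAt (fun ε : ℝ => centroidPt δ A + (ε * σ) • eLast δ) 0 := by
          fun_prop
        exact (hcont.eventually_mem ((isClosed_smp δ S).isOpen_compl.mem_nhds
          (by simpa using hx))).filter_mono nhdsWithin_le_nhds
    obtain ⟨ε, hε, w, hw0, hw1, hwp⟩ :=
      (hev.and (hAH.exists_pos_weights hδ hA hHcard)).exists
    obtain ⟨S, hS, hmem⟩ := hT.exists_mem_smp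
      (smp_mono hH (mem_smp_iff.2 ⟨w, fun a ha => (hw0 a ha).le, hw1, hwp⟩))
    exact hε S hS hmem
  refine ⟨S, hS, isSignedFace_of_mem_smp hδ hA (hT.1 S hS).2 hσ ?_ hε hεS⟩
  have hinter : centroidPt δ A ∈ smp δ (S ∩ S₀) := by
    rw [← hT.2.2 S hS S₀ hS₀]
    exact ⟨hxS, centroidPt_mem_smp hA hAS₀⟩
  rw [← sum_unifWeight_smul hAS₀] at hinter
  exact (subset_of_pos_weights hδ (hT.1 S₀ hS₀).2.le inter_subset_right hAS₀
    (sum_unifWeight hA hAS₀) (fun a ha => unifWeight_pos ha) hinter).trans inter_subset_left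

theorem IsTriangulation.eq_of_isSignedFace {m δ : ℕ} {T : Finset (Finset ℕ)}
    (hT : IsTriangulation m δ T) (hδ : 1 ≤ δ) {A S S' : Finset ℕ} {σ : ℝ} (hA : A.Nonempty)
    (hS : S ∈ T) (hS' : S' ∈ T) (hAS : IsSignedFace σ A S) (hAS' : IsSignedFace σ A S') :
    S = S' := by
  have hcard := (hT.1 S hS).2
  have hcard' := (hT.1 S' hS').2
  obtain ⟨ε, ⟨w, hw0, hw1, hwp⟩, w', hw0', hw1', hwp'⟩ :=
    ((hAS.exists_pos_weights hδ hA hcard).and (hAS'.exists_pos_weights hδ hA hcard')).exists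
  have hinter : ∑ a ∈ S, w a • momCurve δ (a : ℝ) ∈ smp δ (S ∩ S') := by
    rw [← hT.2.2 S hS S' hS']
    exact ⟨mem_smp_iff.2 ⟨w, fun a ha => (hw0 a ha).le, hw1, rfl⟩,
      mem_smp_iff.2 ⟨w', fun a ha => (hw0' a ha).le, hw1', hwp'.trans hwp.symm⟩⟩
  have hsub := subset_of_pos_weights hδ hcard.le inter_subset_left subset_rfl hw1 hw0 hinter
  exact eq_of_subset_of_card_le (hsub.trans inter_subset_right) (by rw [hcard, hcard'])

/-! ### Elements of a given sign -/

/-- The elements of `S` of sign `σ`. -/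
def signPart (σ : ℝ) (S : Finset ℕ) : Finset ℕ := {h ∈ S | (-1 : ℝ) ^ numAbove S h = σ}

theorem numAbove_insert_of_gt {S : Finset ℕ} {a h : ℕ} (hah : a ≤ h) :
    numAbove (insert a S) h = numAbove S h := by
  rw [numAbove, numAbove, filter_insert, if_neg (by lia)]

theorem card_signPart (S : Finset ℕ) :
    #(signPart 1 S) = (#S + 1) / 2 ∧ #(signPart (-1) S) = #S / 2 := by
  induction S using Finset.induction_on_min with
  | empty => simp [signPart]
  | insert a S ha ih =>
    have haS : a ∉ S := fun h => lt_irrefl a (ha a h)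
    have habove : numAbove (insert a S) a = #S := by
      rw [numAbove_insert_of_gt le_rfl, numAbove, filter_true_of_mem ha]
    have hrest : ∀ σ : ℝ, {h ∈ S | (-1 : ℝ) ^ numAbove (insert a S) h = σ} = signPart σ S :=
      fun σ => filter_congr fun h hh => by rw [numAbove_insert_of_gt (ha h hh).le]
    have hnot : ∀ σ : ℝ, a ∉ signPart σ S := fun σ h => haS (mem_filter.1 h).1
    simp only [signPart, filter_insert, habove, card_insert_of_notMem haS]
    simp only [hrest]
    rcases Nat.even_or_odd #S with hev | hodd
    · rw [hev.neg_one_pow, if_pos rfl, if_neg (by norm_num), card_insert_of_notMem (hnot 1)]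
      obtain ⟨k, hk⟩ := hev
      lia
    · rw [hodd.neg_one_pow, if_pos rfl, if_neg (by norm_num), card_insert_of_notMem (hnot _)]
      obtain ⟨k, hk⟩ := hodd
      lia

theorem isSignedFace_signPart_one (S : Finset ℕ) : IsSignedFace (-1) (signPart 1 S) S := by
  refine ⟨filter_subset _ _, fun h hh hh' => ?_⟩
  exact (neg_one_pow_eq_or ℝ _).resolve_left fun h1 => hh' (mem_filter.2 ⟨hh, h1⟩)

theorem IsSignedFace.signPart_eq {A S : Finset ℕ} (hAS : IsSignedFace (-1) A S)
    (hcard : #A ≤ (#S + 1) / 2) : signPart 1 S = A := by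
  refine eq_of_subset_of_card_le (fun h hh => ?_) (by rwa [(card_signPart S).1])
  obtain ⟨hhS, hh1⟩ := mem_filter.1 hh
  by_contra hhA
  rw [hAS.2 h hhS hhA] at hh1
  norm_num at hh1

theorem numAbove_eq_succ {S : Finset ℕ} {a : ℕ} (ha : a + 1 ∈ S) :
    numAbove S a = numAbove S (a + 1) + 1 := by
  rw [numAbove, numAbove, ← card_insert_of_notMem (a := a + 1) (by simp)]
  congr 1
  ext x
  simp only [mem_filter, mem_insert]
  constructor
  · rintro ⟨hx, hax⟩
    by_cases h : x = a + 1
    · exact Or.inl h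
    · exact Or.inr ⟨hx, by lia⟩
  · rintro (rfl | ⟨hx, hax⟩)
    · exact ⟨ha, by lia⟩
    · exact ⟨hx, by lia⟩

theorem succ_notMem_signPart {σ : ℝ} (hσ : σ ≠ 0) {S : Finset ℕ} {a : ℕ} (ha : a ∈ signPart σ S) :
    a + 1 ∉ signPart σ S := by
  intro ha'
  obtain ⟨-, h1⟩ := mem_filter.1 ha
  obtain ⟨hS', h2⟩ := mem_filter.1 ha'
  rw [numAbove_eq_succ hS', pow_succ, h2] at h1
  exact hσ (by linarith)

/-- A set without consecutive elements is the set of elements of positive sign of a set in the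
same range. -/
theorem exists_isSignedFace_of_succ_notMem {d m : ℕ} {A : Finset ℕ} (hcard : #A = d + 1)
    (hAm : A ⊆ Icc 1 m) (hA : ∀ a ∈ A, a + 1 ∉ A) :
    ∃ H ⊆ Icc 1 m, #H = 2 * d + 1 ∧ IsSignedFace (-1) A H := by
  have hne : A.Nonempty := card_pos.1 (by lia)
  set M := A.max' hne
  have hM : M ∈ A := A.max'_mem hne
  have hle : ∀ a ∈ A, a ≤ M := fun a ha => A.le_max' a ha
  set B := (A.erase M).image (· + 1)
  have hB : ∀ {b}, b ∈ B ↔ ∃ a ∈ A, a ≠ M ∧ a + 1 = b := by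
    intro b
    simp only [B, mem_image, mem_erase]
    exact ⟨fun ⟨a, ⟨h1, h2⟩, h3⟩ => ⟨a, h2, h1, h3⟩, fun ⟨a, h2, h1, h3⟩ => ⟨a, ⟨h1, h2⟩, h3⟩⟩
  have hdisj : Disjoint A B := by
    rw [disjoint_left]
    rintro b hb hb'
    obtain ⟨a, ha, -, rfl⟩ := hB.1 hb'
    exact hA a ha hb
  refine ⟨A ∪ B, union_subset hAm fun b hb => ?_, ?_, subset_union_left, fun h hh hhA => ?_⟩
  · obtain ⟨a, ha, haM, rfl⟩ := hB.1 hb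
    have h1 := mem_Icc.1 (hAm hM)
    have h2 := hle a ha
    exact mem_Icc.2 ⟨by lia, by lia⟩
  · rw [card_union_of_disjoint hdisj, card_image_of_injective _ (add_left_injective 1),
      card_erase_of_mem hM]
    lia
  · obtain ⟨a, ha, haM, rfl⟩ := hB.1 ((mem_union.1 hh).resolve_left hhA)
    have hlt : a < M := lt_of_le_of_ne (hle a ha) haM
    have hA' : {x ∈ A | a + 1 < x} = {x ∈ A | a < x} := filter_congr fun x hx =>
      ⟨fun h => by lia, fun h => lt_of_le_of_ne h fun e => hA a ha (e ▸ hx)⟩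
    have hB' : {x ∈ B | a + 1 < x} = ({x ∈ A | a < x}.erase M).image (· + 1) := by
      ext x
      simp only [mem_filter, hB, mem_image, mem_erase]
      constructor
      · rintro ⟨⟨y, hy, hyM, rfl⟩, hx⟩
        exact ⟨y, ⟨hyM, hy, by lia⟩, rfl⟩
      · rintro ⟨y, ⟨hyM, hy, hay⟩, rfl⟩
        exact ⟨⟨y, hy, hyM, rfl⟩, by lia⟩
    have hMmem : M ∈ {x ∈ A | a < x} := mem_filter.2 ⟨hM, hlt⟩
    have hpos : 0 < #{x ∈ A | a < x} := card_pos.2 ⟨M, hMmem⟩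
    refine Odd.neg_one_pow ?_
    rw [numAbove, filter_union, card_union_of_disjoint
      (disjoint_filter_filter hdisj), hA', hB',
      card_image_of_injective _ (add_left_injective 1), card_erase_of_mem hMmem]
    exact ⟨#{x ∈ A | a < x} - 1, by lia⟩

theorem IsTriangulation.ncard_eq_card {d m : ℕ} {T : Finset (Finset ℕ)}
    (hT : IsTriangulation m (2 * d) T) (hd : 1 ≤ d) :
    Set.ncard {A : Finset ℕ | A.card = d + 1 ∧ IsFace T A ∧ ∀ a ∈ A, a + 1 ∉ A} = #T := by
  have hcard : ∀ S ∈ T, #(signPart 1 S) = d + 1 := fun S hS => by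
    rw [(card_signPart S).1, (hT.1 S hS).2]
    lia
  have heq : {A : Finset ℕ | A.card = d + 1 ∧ IsFace T A ∧ ∀ a ∈ A, a + 1 ∉ A} =
      (T.image (signPart 1) : Finset (Finset ℕ)) := by
    ext A
    simp only [Set.mem_ofPred_eq, coe_image, Set.mem_image, mem_coe]
    constructor
    · rintro ⟨hAcard, hface, hA⟩
      obtain ⟨S₀, hS₀, hAS₀⟩ := hface
      obtain ⟨H, hH, hHcard, hAH⟩ := exists_isSignedFace_of_succ_notMem hAcard
        (hAS₀.trans (hT.1 S₀ hS₀).1) hA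
      obtain ⟨S, hS, hAS⟩ := hT.exists_isSignedFace (by lia) (card_pos.1 (by lia)) (Or.inr rfl)
        ⟨S₀, hS₀, hAS₀⟩ hH hHcard hAH
      exact ⟨S, hS, hAS.signPart_eq (by rw [hAcard, (hT.1 S hS).2]; lia)⟩
    · rintro ⟨S, hS, rfl⟩
      exact ⟨hcard S hS, ⟨S, hS, filter_subset _ _⟩,
        fun a ha => succ_notMem_signPart one_ne_zero ha⟩
  rw [heq, Set.ncard_coe_finset]
  refine card_image_of_injOn fun S hS R hR h => ?_
  have hSR : signPart 1 S = signPart 1 R := h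
  exact hT.eq_of_isSignedFace (by lia) (card_pos.1 (by rw [hcard S hS]; lia)) hS hR
    (isSignedFace_signPart_one S) (hSR ▸ isSignedFace_signPart_one R)

/-! ### Facets of a triangulation -/

/-- The facets obtained by removing an element of sign `σ` from a simplex of `T`. -/
def signedFacets (σ : ℝ) (T : Finset (Finset ℕ)) : Finset (Finset ℕ) :=
  T.biUnion fun S => (signPart σ S).image S.erase

theorem isSignedFace_erase {σ : ℝ} {S : Finset ℕ} {h : ℕ} (hh : h ∈ signPart σ S) :
    IsSignedFace σ (S.erase h) S := by
  refine ⟨erase_subset _ _, fun a ha ha' => ?_⟩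
  obtain rfl : a = h := by
    by_contra hne
    exact ha' (mem_erase.2 ⟨hne, ha⟩)
  exact (mem_filter.1 hh).2

theorem mem_signedFacets {m δ : ℕ} {T : Finset (Finset ℕ)} (hT : IsTriangulation m δ T) {σ : ℝ}
    {F : Finset ℕ} : F ∈ signedFacets σ T ↔ #F = δ ∧ ∃ S ∈ T, IsSignedFace σ F S := by
  simp only [signedFacets, mem_biUnion, mem_image]
  constructor
  · rintro ⟨S, hS, h, hh, rfl⟩
    refine ⟨?_, S, hS, isSignedFace_erase hh⟩
    rw [card_erase_of_mem (mem_filter.1 hh).1, (hT.1 S hS).2, Nat.add_sub_cancel]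
  · rintro ⟨hF, S, hS, hFS⟩
    have hcard := (hT.1 S hS).2
    obtain ⟨h, hh, hhF⟩ := exists_mem_notMem_of_card_lt_card (show #F < #S by lia)
    refine ⟨S, hS, h, mem_filter.2 ⟨hh, hFS.2 h hh hhF⟩, ?_⟩
    refine (eq_of_subset_of_card_le (subset_erase.2 ⟨hFS.1, hhF⟩) ?_).symm
    rw [card_erase_of_mem hh]
    lia

theorem card_signedFacets {m δ : ℕ} {T : Finset (Finset ℕ)} (hT : IsTriangulation m δ T)
    (hδ : 1 ≤ δ) (σ : ℝ) : #(signedFacets σ T) = ∑ S ∈ T, #(signPart σ S) := by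
  rw [signedFacets, card_biUnion]
  · refine sum_congr rfl fun S _ => card_image_of_injOn fun a ha b _ hab => ?_
    exact (erase_inj S (mem_filter.1 ha).1).1 hab
  · intro S hS S' hS' hne
    rw [Function.onFun, disjoint_left]
    intro F hF hF'
    obtain ⟨h, hh, rfl⟩ := mem_image.1 hF
    obtain ⟨h', hh', heq⟩ := mem_image.1 hF'
    have hcard : #(S.erase h) = δ := by
      rw [card_erase_of_mem (mem_filter.1 hh).1, (hT.1 S hS).2, Nat.add_sub_cancel]
    exact hne (hT.eq_of_isSignedFace hδ (card_pos.1 (by lia)) hS hS' (isSignedFace_erase hh)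
      (heq ▸ isSignedFace_erase hh'))

/-- Gale's evenness (or oddness) condition: every element of `{1, …, m} ∖ F` has sign `σ` with
respect to `F`. -/
def IsGale (σ : ℝ) (m : ℕ) (F : Finset ℕ) : Prop :=
  ∀ i ∈ Icc 1 m, i ∉ F → (-1 : ℝ) ^ numAbove F i = σ

open scoped Classical in
/-- The `k`-subsets of `{1, …, m}` satisfying Gale's condition for the sign `σ`. -/
def galeSets (σ : ℝ) (m k : ℕ) : Finset (Finset ℕ) :=
  {F ∈ powersetCard k (Icc 1 m) | IsGale σ m F}

theorem mem_galeSets {σ : ℝ} {m k : ℕ} {F : Finset ℕ} : F ∈ galeSets σ m k ↔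
    (F ⊆ Icc 1 m ∧ #F = k) ∧ ∀ i ∈ Icc 1 m, i ∉ F → (-1 : ℝ) ^ numAbove F i = σ := by
  classical
  rw [galeSets, mem_filter, mem_powersetCard, IsGale]

theorem numAbove_insert_self (S : Finset ℕ) (h : ℕ) : numAbove (insert h S) h = numAbove S h :=
  numAbove_insert_of_gt le_rfl

/-- A set satisfying Gale's evenness condition is a face of every simplex containing its
centroid. -/
theorem subset_of_mem_galeSets {m δ : ℕ} (hδ : 1 ≤ δ) {σ : ℝ} {F S : Finset ℕ}
    (hF : F ∈ galeSets σ m δ) (hS : S ⊆ Icc 1 m) (hmem : centroidPt δ F ∈ smp δ S) : F ⊆ S := by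
  obtain ⟨⟨hFm, hFcard⟩, hgale⟩ := mem_galeSets.1 hF
  have hne : F.Nonempty := card_pos.1 (by lia)
  obtain ⟨u, hu0, hu1, hup⟩ := mem_smp_iff.1 hmem
  have heq := sum_mul_eval_eq hδ (S := S) (A := F) (u := u) (w := unifWeight F) (s := 0)
    (by rw [hu1, sum_unifWeight hne subset_rfl]) (by rw [hup, zero_smul, add_zero, centroidPt])
    (P := vanishPoly F) (by rw [natDegree_vanishPoly, hFcard])
  rw [sum_eq_zero (s := F) fun a ha => by rw [eval_vanishPoly_eq_zero ha, mul_zero], zero_mul,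
    add_zero] at heq
  have hpos : ∀ a ∈ S, a ∉ F → 0 < σ * (vanishPoly F).eval (a : ℝ) := fun a ha haF => by
    rw [← hgale a (hS ha) haF]
    exact sign_mul_eval_vanishPoly_pos haF
  have hzero : ∀ a ∈ S, a ∉ F → u a = 0 := by
    have hsum : ∑ a ∈ S, u a * (σ * (vanishPoly F).eval (a : ℝ)) = 0 := by
      rw [← mul_zero σ, ← heq, mul_sum]
      exact sum_congr rfl fun a _ => by ring
    rw [sum_eq_zero_iff_of_nonneg] at hsum
    · intro a ha haF
      exact (mul_eq_zero.1 (hsum a ha)).resolve_right (hpos a ha haF).ne'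
    · intro a ha
      by_cases haF : a ∈ F
      · simp [eval_vanishPoly_eq_zero haF]
      · exact mul_nonneg (hu0 a ha) (hpos a ha haF).le
  have hsub : ∀ a ∈ S, a ∉ S ∩ F → u a = 0 := fun a ha ha' =>
    hzero a ha fun haF => ha' (mem_inter.2 ⟨ha, haF⟩)
  have hmem' : centroidPt δ F ∈ smp δ (S ∩ F) := by
    refine mem_smp_iff.2 ⟨u, fun a ha => hu0 a (mem_inter.1 ha).1, ?_, ?_⟩
    · rw [sum_subset inter_subset_left hsub, hu1]
    · rw [sum_subset inter_subset_left fun a ha ha' => by rw [hsub a ha ha', zero_smul], hup]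
  rw [← sum_unifWeight_smul subset_rfl] at hmem'
  exact (subset_of_pos_weights hδ (by lia) inter_subset_right subset_rfl
    (sum_unifWeight hne subset_rfl) (fun a ha => unifWeight_pos ha) hmem').trans inter_subset_left

theorem signedFacets_sdiff {m δ : ℕ} {T : Finset (Finset ℕ)} (hT : IsTriangulation m δ T)
    (hδ : 1 ≤ δ) {σ : ℝ} (hσ : σ = 1 ∨ σ = -1) :
    signedFacets σ T \ signedFacets (-σ) T = galeSets σ m δ := by
  have hσ' : -σ = 1 ∨ -σ = -1 := by
    rcases hσ with rfl | rfl <;> simp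
  have hσne : σ ≠ -σ := by
    rcases hσ with rfl | rfl <;> norm_num
  ext F
  rw [mem_sdiff, mem_signedFacets hT, mem_signedFacets hT, mem_galeSets]
  constructor
  · rintro ⟨⟨hF, S, hS, hFS⟩, hnot⟩
    refine ⟨⟨hFS.1.trans (hT.1 S hS).1, hF⟩, fun i hi hiF => ?_⟩
    by_contra hsign
    have hsign' : (-1 : ℝ) ^ numAbove F i = -σ := by
      rcases neg_one_pow_eq_or ℝ (numAbove F i) with h | h <;> rcases hσ with rfl | rfl <;>
        simp_all
    refine hnot ⟨hF, hT.exists_isSignedFace hδ (card_pos.1 (by lia)) hσ' ⟨S, hS, hFS.1⟩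
      (H := insert i F) (insert_subset hi (hFS.1.trans (hT.1 S hS).1))
      (by rw [card_insert_of_notMem hiF, hF]) ⟨subset_insert _ _, fun h hh hhF => ?_⟩⟩
    obtain rfl := (mem_insert.1 hh).resolve_right hhF
    rw [numAbove_insert_self, hsign']
  · intro hF
    have hcard : ∀ S ∈ T, F ⊆ S → ∃ h ∈ Icc 1 m, h ∉ F ∧ S = insert h F := by
      intro S hS hFS
      obtain ⟨h, hh, hhF⟩ := exists_mem_notMem_of_card_lt_card
        (show #F < #S by rw [hF.1.2, (hT.1 S hS).2]; lia)
      refine ⟨h, (hT.1 S hS).1 hh, hhF, (eq_of_subset_of_card_le (insert_subset hh hFS) ?_).symm⟩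
      rw [card_insert_of_notMem hhF, (hT.1 S hS).2, hF.1.2]
    refine ⟨⟨hF.1.2, ?_⟩, ?_⟩
    · obtain ⟨S, hS, hmem⟩ := hT.exists_mem_smp
        (centroidPt_mem_smp (card_pos.1 (by lia)) hF.1.1)
      have hFS := subset_of_mem_galeSets hδ (mem_galeSets.2 hF) (hT.1 S hS).1 hmem
      refine ⟨S, hS, hFS, fun a ha haF => ?_⟩
      obtain ⟨h, hhm, hhF, rfl⟩ := hcard S hS hFS
      obtain rfl := (mem_insert.1 ha).resolve_right haF
      rw [numAbove_insert_self, hF.2 a hhm haF]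
    · rintro ⟨-, S, hS, hFS⟩
      obtain ⟨h, hhm, hhF, rfl⟩ := hcard S hS hFS.1
      have h1 := hFS.2 h (mem_insert_self _ _) hhF
      rw [numAbove_insert_self, hF.2 h hhm hhF] at h1
      exact hσne h1

/-! ### Counting -/

theorem galeSets_eq_empty {σ : ℝ} {m k : ℕ} (hmk : m < k) : galeSets σ m k = ∅ := by
  refine eq_empty_of_forall_notMem fun F hF => ?_
  obtain ⟨⟨hFm, hFcard⟩, -⟩ := mem_galeSets.1 hF
  have := card_le_card hFm
  rw [Nat.card_Icc] at this
  lia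

theorem galeSets_one_zero (m : ℕ) : galeSets 1 m 0 = {∅} := by
  ext F
  rw [mem_galeSets, mem_singleton, card_eq_zero]
  refine ⟨fun h => h.1.2, ?_⟩
  rintro rfl
  exact ⟨⟨empty_subset _, rfl⟩, fun i _ _ => by simp [numAbove]⟩

theorem galeSets_zero_zero (σ : ℝ) : galeSets σ 0 0 = {∅} := by
  ext F
  rw [mem_galeSets, mem_singleton, card_eq_zero]
  refine ⟨fun h => h.1.2, ?_⟩
  rintro rfl
  exact ⟨⟨empty_subset _, rfl⟩, fun i hi _ => by simp at hi⟩

theorem galeSets_neg_one_zero (m : ℕ) : galeSets (-1) (m + 1) 0 = ∅ := by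
  refine eq_empty_of_forall_notMem fun F hF => ?_
  obtain ⟨⟨-, hF0⟩, hgale⟩ := mem_galeSets.1 hF
  obtain rfl := card_eq_zero.1 hF0
  have := hgale 1 (by simp) (by simp)
  simp [numAbove] at this
  norm_num at this

theorem numAbove_eq_zero {m : ℕ} {F : Finset ℕ} (hF : F ⊆ Icc 1 m) : numAbove F m = 0 := by
  rw [numAbove, card_eq_zero, filter_eq_empty_iff]
  intro x hx
  have := mem_Icc.1 (hF hx)
  lia

theorem filter_notMem_galeSets (m k : ℕ) :
    {F ∈ galeSets 1 (m + 1) k | m + 1 ∉ F} = galeSets 1 m k := by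
  ext F
  rw [mem_filter, mem_galeSets, mem_galeSets]
  constructor
  · rintro ⟨⟨⟨hF, hk⟩, hgale⟩, hmF⟩
    refine ⟨⟨fun x hx => ?_, hk⟩, fun i hi => hgale i ?_⟩
    · have h1 := mem_Icc.1 (hF hx)
      have h2 : x ≠ m + 1 := ne_of_mem_of_not_mem hx hmF
      exact mem_Icc.2 ⟨h1.1, by lia⟩
    · exact Icc_subset_Icc_right (Nat.le_succ m) hi
  · rintro ⟨⟨hF, hk⟩, hgale⟩
    have hF' : F ⊆ Icc 1 (m + 1) := hF.trans (Icc_subset_Icc_right (Nat.le_succ m))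
    refine ⟨⟨⟨hF', hk⟩, fun i hi hiF => ?_⟩, fun hmF => ?_⟩
    · by_cases him : i = m + 1
      · rw [him, numAbove_eq_zero hF', pow_zero]
      · have := mem_Icc.1 hi
        exact hgale i (mem_Icc.2 ⟨this.1, by lia⟩) hiF
    · have := mem_Icc.1 (hF hmF)
      lia

theorem filter_notMem_galeSets_neg (m k : ℕ) :
    {F ∈ galeSets (-1) (m + 1) k | m + 1 ∉ F} = ∅ := by
  rw [filter_eq_empty_iff]
  intro F hF
  obtain ⟨⟨hFm, -⟩, hgale⟩ := mem_galeSets.1 hF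
  by_contra hmF
  have := hgale (m + 1) (by simp) hmF
  rw [numAbove_eq_zero hFm] at this
  norm_num at this

theorem numAbove_insert_of_lt {S : Finset ℕ} {a h : ℕ} (ha : a ∉ S) (hah : h < a) :
    numAbove (insert a S) h = numAbove S h + 1 := by
  rw [numAbove, numAbove, filter_insert, if_pos hah,
    card_insert_of_notMem fun h => ha (mem_filter.1 h).1]

theorem card_filter_mem_galeSets (σ : ℝ) (m k : ℕ) :
    #{F ∈ galeSets σ (m + 1) (k + 1) | m + 1 ∈ F} = #(galeSets (-σ) m k) := by
  have hnot : ∀ {F : Finset ℕ}, F ⊆ Icc 1 m → m + 1 ∉ F := fun hF h => by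
    have := mem_Icc.1 (hF h)
    lia
  refine (card_bij (fun F _ => insert (m + 1) F) ?_ ?_ ?_).symm
  · intro F hF
    obtain ⟨⟨hFm, hk⟩, hgale⟩ := mem_galeSets.1 hF
    refine mem_filter.2 ⟨mem_galeSets.2 ⟨⟨?_, ?_⟩, fun i hi hiF => ?_⟩, mem_insert_self _ _⟩
    · exact insert_subset (by simp) (hFm.trans (Icc_subset_Icc_right (Nat.le_succ m)))
    · rw [card_insert_of_notMem (hnot hFm), hk]
    · rw [mem_insert, not_or] at hiF
      have hi' := mem_Icc.1 hi
      have him : i < m + 1 := lt_of_le_of_ne hi'.2 hiF.1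
      rw [numAbove_insert_of_lt (hnot hFm) him, pow_succ,
        hgale i (mem_Icc.2 ⟨hi'.1, by lia⟩) hiF.2]
      ring
  · intro F hF F' hF' h
    rw [← erase_insert (hnot (mem_galeSets.1 hF).1.1), h,
      erase_insert (hnot (mem_galeSets.1 hF').1.1)]
  · intro F hF
    obtain ⟨hF, hmF⟩ := mem_filter.1 hF
    obtain ⟨⟨hFm, hk⟩, hgale⟩ := mem_galeSets.1 hF
    refine ⟨F.erase (m + 1), mem_galeSets.2 ⟨⟨fun x hx => ?_, ?_⟩, fun i hi hiF => ?_⟩,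
      insert_erase hmF⟩
    · obtain ⟨hne, hx⟩ := mem_erase.1 hx
      have := mem_Icc.1 (hFm hx)
      exact mem_Icc.2 ⟨this.1, by lia⟩
    · rw [card_erase_of_mem hmF, hk, Nat.add_sub_cancel]
    · have hi' := mem_Icc.1 hi
      have him : i < m + 1 := by lia
      have hiF' : i ∉ F := fun h => hiF (mem_erase.2 ⟨him.ne, h⟩)
      have h := hgale i (mem_Icc.2 ⟨hi'.1, by lia⟩) hiF'
      rw [← insert_erase hmF, numAbove_insert_of_lt (notMem_erase _ _) him, pow_succ] at h
      linarith

theorem card_galeSets_neg (m k : ℕ) :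
    #(galeSets (-1) (m + 1) (k + 1)) = #(galeSets 1 m k) := by
  rw [← card_filter_add_card_filter_not (p := fun F => m + 1 ∈ F), card_filter_mem_galeSets,
    filter_notMem_galeSets_neg, neg_neg, card_empty, add_zero]

theorem card_galeSets_succ (m k : ℕ) :
    #(galeSets 1 (m + 1) (k + 1)) = #(galeSets 1 m (k + 1)) + #(galeSets (-1) m k) := by
  rw [← card_filter_add_card_filter_not (p := fun F => m + 1 ∈ F), card_filter_mem_galeSets,
    filter_notMem_galeSets, add_comm]

theorem card_galeSets_one_one (m : ℕ) : #(galeSets 1 (m + 1) 1) = 1 := by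
  induction m with
  | zero =>
    rw [card_galeSets_succ, galeSets_eq_empty (by lia), galeSets_zero_zero, card_empty,
      card_singleton]
  | succ m ih => rw [card_galeSets_succ, ih, galeSets_neg_one_zero, card_empty]

theorem card_galeSets_add {e : ℕ} (he : ∀ m, #(galeSets 1 (m + e) e) = 1) (d m : ℕ) :
    #(galeSets 1 (m + e) (2 * d + e)) = (m - d).choose d := by
  induction d generalizing m with
  | zero => simpa using he m
  | succ d ihd =>
    have hsmall : ∀ m < 2, #(galeSets 1 (m + e) (2 * (d + 1) + e)) =
        (m - (d + 1)).choose (d + 1) := fun m hm => by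
      rw [galeSets_eq_empty (by lia), card_empty, Nat.choose_eq_zero_of_lt (by lia)]
    induction m using Nat.twoStepInduction with
    | zero => exact hsmall 0 (by lia)
    | one => exact hsmall 1 (by lia)
    | more m _ ih =>
      rw [show m + 2 + e = (m + e + 1) + 1 by lia, show 2 * (d + 1) + e = (2 * d + e + 1) + 1 by lia,
        card_galeSets_succ, card_galeSets_neg, ihd,
        show m + e + 1 = m + 1 + e by lia, show 2 * d + e + 1 + 1 = 2 * (d + 1) + e by lia, ih]
      rcases le_or_gt d m with h | h
      · rw [show m + 2 - (d + 1) = (m - d) + 1 by lia, show m + 1 - (d + 1) = m - d by lia,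
          Nat.choose_succ_succ, add_comm]
      · rw [Nat.choose_eq_zero_of_lt (by lia), Nat.choose_eq_zero_of_lt (by lia),
          Nat.choose_eq_zero_of_lt (by lia)]

theorem IsTriangulation.card_eq {d m : ℕ} {T : Finset (Finset ℕ)}
    (hT : IsTriangulation m (2 * d) T) (hd : 1 ≤ d) (hm : 2 * d + 1 ≤ m) :
    #T = (m - d - 1).choose d := by
  have hδ : 1 ≤ 2 * d := by lia
  have hL : #(signedFacets 1 T) = #T * (d + 1) := by
    rw [card_signedFacets hT hδ, sum_const_nat fun S hS => ?_]
    rw [(card_signPart S).1, (hT.1 S hS).2]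
    lia
  have hU : #(signedFacets (-1) T) = #T * d := by
    rw [card_signedFacets hT hδ, sum_const_nat fun S hS => ?_]
    rw [(card_signPart S).2, (hT.1 S hS).2]
    lia
  have hLU := card_sdiff_add_card (signedFacets 1 T) (signedFacets (-1) T)
  have hUL := card_sdiff_add_card (signedFacets (-1) T) (signedFacets 1 T)
  rw [signedFacets_sdiff hT hδ (Or.inl rfl)] at hLU
  have hsd := signedFacets_sdiff hT hδ (Or.inr rfl)
  rw [neg_neg] at hsd
  rw [hsd, union_comm] at hUL
  obtain ⟨e, rfl⟩ := Nat.exists_eq_add_of_le' hd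
  obtain ⟨n, rfl⟩ := Nat.exists_eq_add_of_le' (show 2 ≤ m by lia)
  have hlow := card_galeSets_add (e := 0) (fun m => by rw [galeSets_one_zero, card_singleton])
    (e + 1) (n + 2)
  have hupp := card_galeSets_add card_galeSets_one_one e n
  rw [← card_galeSets_neg] at hupp
  simp only [add_zero] at hlow
  rw [show 2 * e + 1 + 1 = 2 * (e + 1) by lia, show n + 1 + 1 = n + 2 by lia] at hupp
  rw [show n + 2 - (e + 1) = (n - e) + 1 by lia, Nat.choose_succ_succ] at hlow
  rw [show n + 2 - (e + 1) - 1 = n - e by lia]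
  lia

/-- a triangulation of `C(m, 2d)` has exactly `(m - d - 1).choose d` many
`d`-faces with no two consecutive entries. -/
theorem statement7 (d m : ℕ) (hd : 1 ≤ d) (hm : 2 * d + 1 ≤ m)
    (T : Finset (Finset ℕ)) (hT : IsTriangulation m (2 * d) T) :
    Set.ncard {A : Finset ℕ | A.card = d + 1 ∧ IsFace T A ∧ ∀ a ∈ A, a + 1 ∉ A}
      = (m - d - 1).choose d := by
  rw [hT.ncard_eq_card hd, hT.card_eq hd hm]
end
end

section
/- Let δ ≥ 1 and m ≥ δ+2 be integers and let 𝒯 be any triangulation of the cyclic polytope C(m, δ). Then 𝒯_low ≤₂ 𝒯 and 𝒯 ≤₂ 𝒯_up, where 𝒯_low and 𝒯_up denote the lower and upper triangulations of C(m, δ); that is, the lower triangulation is the minimum and the upper triangulation the maximum of the second higher Stasheff–Tamari order. -/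
open Finset

noncomputable section

/-- The affine functional on `ℝ^n` whose value at `p_n(t)` is `Q(t)` when `deg Q ≤ n`. -/
def momFunctional (n : ℕ) (Q : Polynomial ℝ) : (Fin n → ℝ) →ᵃ[ℝ] ℝ :=
  (Fintype.linearCombination ℝ fun i : Fin n => Q.coeff (i.1 + 1)).toAffineMap +
    AffineMap.const ℝ (Fin n → ℝ) (Q.coeff 0)

lemma momFunctional_apply (n : ℕ) (Q : Polynomial ℝ) (y : Fin n → ℝ) :
    momFunctional n Q y = ∑ i : Fin n, y i * Q.coeff (i.1 + 1) + Q.coeff 0 := by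
  simp [momFunctional, Fintype.linearCombination_apply]

lemma momFunctional_momCurve {n : ℕ} {Q : Polynomial ℝ} (hQ : Q.natDegree ≤ n) (t : ℝ) :
    momFunctional n Q (momCurve n t) = Q.eval t := by
  rw [momFunctional_apply, Polynomial.eval_eq_sum_range' (Nat.lt_succ_of_le hQ),
    Finset.sum_range_succ', Finset.sum_range]
  simp [momCurve, mul_comm]

lemma lastCoord_succ {δ : ℕ} (y : Fin (δ + 1) → ℝ) : lastCoord y = y (Fin.last δ) := by
  simp [lastCoord, Fin.last]

/-- The monic polynomial whose roots are the elements of `F`. -/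
def nodePoly (F : Finset ℕ) : Polynomial ℝ :=
  ∏ a ∈ F, (Polynomial.X - Polynomial.C (a : ℝ))

lemma nodePoly_natDegree (F : Finset ℕ) : (nodePoly F).natDegree = F.card :=
  Polynomial.natDegree_finsetProd_X_sub_C_eq_card F _

lemma nodePoly_coeff_card (F : Finset ℕ) : (nodePoly F).coeff F.card = 1 := by
  rw [← nodePoly_natDegree]
  exact Polynomial.monic_prod_X_sub_C _ F

lemma nodePoly_eval_eq_zero {F : Finset ℕ} {a : ℕ} (ha : a ∈ F) :
    (nodePoly F).eval (a : ℝ) = 0 := by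
  rw [nodePoly, Polynomial.eval_prod]
  exact Finset.prod_eq_zero ha (by simp)

lemma momFunctional_nodePoly_eq_zero {n : ℕ} {F : Finset ℕ} (hF : F.card = n)
    {z : Fin n → ℝ} (hz : z ∈ affineSpan ℝ (momPts n F)) :
    momFunctional n (nodePoly F) z = 0 := by
  refine AffineMap.eqOn_affineSpan
    (f := momFunctional n (nodePoly F)) (g := AffineMap.const ℝ _ 0) ?_ hz
  rintro _ ⟨a, ha, rfl⟩
  simpa [momFunctional_momCurve ((nodePoly_natDegree F).trans hF).le] using
    nodePoly_eval_eq_zero ha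

/-- The height of `p_n(t)` over the affine hull of `p_n(F)`, measured along `e_n`, is the value at
`t` of the monic polynomial vanishing on `F`. -/
lemma nodePoly_eval_eq_of_sub_smul_eLast_mem {δ : ℕ} {F : Finset ℕ} (hF : F.card = δ + 1)
    {t r : ℝ} (h : momCurve (δ + 1) t - r • eLast (δ + 1) ∈ affineSpan ℝ (momPts (δ + 1) F)) :
    (nodePoly F).eval t = r := by
  have h0 := momFunctional_nodePoly_eq_zero hF h
  have h1 := momFunctional_momCurve ((nodePoly_natDegree F).trans hF).le t
  have hlead : (nodePoly F).coeff (δ + 1) = 1 := hF ▸ nodePoly_coeff_card F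
  have h2 : ∑ i : Fin (δ + 1), eLast (δ + 1) i * (nodePoly F).coeff (i.1 + 1) = 1 := by
    rw [Fin.sum_univ_castSucc, Finset.sum_eq_zero]
    · simp [eLast, hlead]
    · intro i _
      simp [eLast, i.2.ne]
  rw [momFunctional_apply] at h0 h1
  simp only [Pi.sub_apply, Pi.smul_apply, smul_eq_mul, sub_mul, Finset.sum_sub_distrib, mul_assoc,
    ← Finset.mul_sum, h2] at h0
  linarith

lemma IsLowerFacet.nodePoly_eval_nonneg {m δ : ℕ} {F : Finset ℕ} (hF : IsLowerFacet m (δ + 1) F)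
    {a : ℕ} (ha : a ∈ Finset.Icc 1 m) : 0 ≤ (nodePoly F).eval (a : ℝ) := by
  by_cases haF : a ∈ F
  · exact (nodePoly_eval_eq_zero haF).ge
  · obtain ⟨r, hr, h⟩ := hF.2.2 a ha haF
    exact (nodePoly_eval_eq_of_sub_smul_eLast_mem hF.2.1 h).symm ▸ hr.le

lemma IsUpperFacet.nodePoly_eval_nonpos {m δ : ℕ} {F : Finset ℕ} (hF : IsUpperFacet m (δ + 1) F)
    {a : ℕ} (ha : a ∈ Finset.Icc 1 m) : (nodePoly F).eval (a : ℝ) ≤ 0 := by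
  by_cases haF : a ∈ F
  · exact (nodePoly_eval_eq_zero haF).le
  · obtain ⟨r, hr, h⟩ := hF.2.2 a ha haF
    exact (nodePoly_eval_eq_of_sub_smul_eLast_mem hF.2.1 h).symm ▸ hr.le

lemma IsLift.momFunctional_eq_lastCoord_add {δ : ℕ} {F S : Finset ℕ} (hF : F.card = δ + 1)
    {x : Fin δ → ℝ} {y : Fin (δ + 1) → ℝ} (h : IsLift δ S x y) :
    momFunctional (δ + 1) (nodePoly F) y = lastCoord y + momFunctional δ (nodePoly F) x := by
  obtain ⟨w, -, -, rfl, rfl⟩ := h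
  have hlead : (nodePoly F).coeff (δ + 1) = 1 := hF ▸ nodePoly_coeff_card F
  simp only [lastCoord_succ, momFunctional_apply, Fin.sum_univ_castSucc]
  simp [momCurve, hlead]
  ring

lemma IsLift.exists_momFunctional_eq_sum {δ : ℕ} {S : Finset ℕ} {Q : Polynomial ℝ}
    (hQ : Q.natDegree ≤ δ + 1) {x : Fin δ → ℝ} {y : Fin (δ + 1) → ℝ} (h : IsLift δ S x y) :
    ∃ w : ℕ → ℝ, (∀ a ∈ S, 0 ≤ w a) ∧
      momFunctional (δ + 1) Q y = ∑ a ∈ S, w a * Q.eval (a : ℝ) := by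
  obtain ⟨w, hw, hw1, -, rfl⟩ := h
  refine ⟨w, hw, ?_⟩
  rw [← Finset.affineCombination_eq_linear_combination S _ w hw1,
    Finset.map_affineCombination S _ w hw1,
    Finset.affineCombination_eq_linear_combination S _ w hw1]
  simp [momFunctional_momCurve hQ]

lemma IsLift.momFunctional_nodePoly_self {δ : ℕ} {F : Finset ℕ} (hF : F.card = δ + 1)
    {x : Fin δ → ℝ} {y : Fin (δ + 1) → ℝ} (h : IsLift δ F x y) :
    momFunctional (δ + 1) (nodePoly F) y = 0 := by
  obtain ⟨w, -, hy⟩ := h.exists_momFunctional_eq_sum ((nodePoly_natDegree F).trans hF).le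
  rw [hy]
  exact Finset.sum_eq_zero fun a ha => by rw [nodePoly_eval_eq_zero ha, mul_zero]

lemma IsLowerFacet.lastCoord_le {m δ : ℕ} {F S : Finset ℕ} (hF : IsLowerFacet m (δ + 1) F)
    (hS : S ⊆ Finset.Icc 1 m) {x : Fin δ → ℝ} {y y' : Fin (δ + 1) → ℝ}
    (hy : IsLift δ F x y) (hy' : IsLift δ S x y') : lastCoord y ≤ lastCoord y' := by
  have h0 := hy.momFunctional_nodePoly_self hF.2.1
  obtain ⟨w, hw, hsum⟩ :=
    hy'.exists_momFunctional_eq_sum ((nodePoly_natDegree F).trans hF.2.1).le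
  have hpos : 0 ≤ ∑ a ∈ S, w a * (nodePoly F).eval (a : ℝ) :=
    Finset.sum_nonneg fun a ha => mul_nonneg (hw a ha) (hF.nodePoly_eval_nonneg (hS ha))
  rw [hy.momFunctional_eq_lastCoord_add hF.2.1] at h0
  rw [hy'.momFunctional_eq_lastCoord_add hF.2.1] at hsum
  linarith

lemma IsUpperFacet.lastCoord_le {m δ : ℕ} {F S : Finset ℕ} (hF : IsUpperFacet m (δ + 1) F)
    (hS : S ⊆ Finset.Icc 1 m) {x : Fin δ → ℝ} {y y' : Fin (δ + 1) → ℝ}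
    (hy : IsLift δ F x y) (hy' : IsLift δ S x y') : lastCoord y' ≤ lastCoord y := by
  have h0 := hy.momFunctional_nodePoly_self hF.2.1
  obtain ⟨w, hw, hsum⟩ :=
    hy'.exists_momFunctional_eq_sum ((nodePoly_natDegree F).trans hF.2.1).le
  have hneg : ∑ a ∈ S, w a * (nodePoly F).eval (a : ℝ) ≤ 0 :=
    Finset.sum_nonpos fun a ha =>
      mul_nonpos_of_nonneg_of_nonpos (hw a ha) (hF.nodePoly_eval_nonpos (hS ha))
  rw [hy.momFunctional_eq_lastCoord_add hF.2.1] at h0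
  rw [hy'.momFunctional_eq_lastCoord_add hF.2.1] at hsum
  linarith

/-- the lower triangulation is the minimum and the upper triangulation the
maximum of the second higher Stasheff–Tamari order. -/
theorem statement11 (δ m : ℕ) (hδ : 1 ≤ δ) (hm : δ + 2 ≤ m)
    (T : Finset (Finset ℕ)) (hT : IsTriangulation m δ T) :
    HST2 δ (lowerTriang m δ) T ∧ HST2 δ T (upperTriang m δ) := by
  classical
  refine ⟨fun F hF S hS x _ y y' hy hy' => ?_, fun S hS F hF x _ y y' hy hy' => ?_⟩
  · exact (Finset.mem_filter.mp hF).2.lastCoord_le (hT.1 S hS).1 hy hy'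
  · exact (Finset.mem_filter.mp hF).2.lastCoord_le (hT.1 S hS).1 hy' hy
end
end
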